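/- arXiv:1003.0297 — 2 statements merged into one kernel-verified Lean document; each statement's English description precedes it below -/
import Mathlib

section
/- For every r ∈ [0,1), the sequence (C_{n,r}/n)_{n≥1} converges and lim_{n→∞} C_{n,r}/n = (1+r)/(1-r). -/
open Complex Filter Finset MeasureTheory Metric

noncomputable section

/-- The `k`-th Taylor coefficient of `f` at `0`. -/
def hcoeff (f : ℂ → ℂ) (k : ℕ) : ℂ := iteratedDeriv k f 0 / (Nat.factorial k : ℂ)

/-- The Hardy space `H²` norm of `f`, computed through the Taylor coefficients at `0`:
`‖f‖₂² = ∑_{k≥0} |f̂(k)|²`. -/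
def h2norm (f : ℂ → ℂ) : ℝ := Real.sqrt (∑' k : ℕ, ‖hcoeff f k‖ ^ 2)

/-- Membership in the Hardy space `H²` of the unit disc: `f` is holomorphic on the unit
disc and its Taylor coefficients are square-summable. -/
def MemH2 (f : ℂ → ℂ) : Prop :=
  DifferentiableOn ℂ f (ball 0 1) ∧ Summable (fun k : ℕ => ‖hcoeff f k‖ ^ 2)

/-- The `H²` inner product `(f,g) = ∑_{k≥0} f̂(k)·conj(ĝ(k))`. -/
def h2inner (f g : ℂ → ℂ) : ℂ := ∑' k : ℕ, hcoeff f k * (starRingEnd ℂ) (hcoeff g k)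

/-- Elementary Blaschke factor `b_λ(z) = (λ - z)/(1 - conj(λ)·z)`. -/
def blaschke (l : ℂ) : ℂ → ℂ := fun z => (l - z) / (1 - (starRingEnd ℂ) l * z)

/-- Membership in the model space `K_B = H² ⊖ B·H²`: `f ∈ H²` and `f` is orthogonal to
`B·g` for every `g ∈ H²`. -/
def MemKB (B f : ℂ → ℂ) : Prop :=
  MemH2 f ∧ ∀ g : ℂ → ℂ, MemH2 g → h2inner f (fun z => B z * g z) = 0

/-- The norm of the differentiation operator `D : K_B → H²`, `Df = f'`. -/
def DNorm (B : ℂ → ℂ) : ℝ :=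
  sSup {x : ℝ | ∃ f : ℂ → ℂ, MemKB B f ∧ h2norm f ≤ 1 ∧ x = h2norm (deriv f)}

/-- `C_{n,r}`: the supremum of `‖D‖_{K_{B_σ} → H²}` over all finite sequences `σ` in the
unit disc with `1 ≤ card σ ≤ n` and `|λ| ≤ r` for all `λ ∈ σ`. -/
def Cnr (n : ℕ) (r : ℝ) : ℝ :=
  sSup {x : ℝ | ∃ m : ℕ, 1 ≤ m ∧ m ≤ n ∧ ∃ l : Fin m → ℂ,
    (∀ j, ‖l j‖ ≤ r) ∧ x = DNorm (fun z => ∏ j, blaschke (l j) z)}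

/-- The Malmquist–Walsh basis function `e_k(z) = (1-r²)^{1/2}/(1-rz) · b_r(z)^{k-1}`
of the model space `K_{b_r^n}`. -/
def mw (r : ℝ) (k : ℕ) : ℂ → ℂ :=
  fun z => (Real.sqrt (1 - r ^ 2) : ℂ) / (1 - (r : ℂ) * z) * (blaschke (r : ℂ) z) ^ (k - 1)

open scoped InnerProductSpace ComplexConjugate

/-- The Hardy space `H²`, realised as the space of square-summable coefficient sequences. -/
abbrev HardySeq : Type := lp (fun _ : ℕ => ℂ) 2

lemma memℓp_two_iff {a : ℕ → ℂ} : Memℓp a 2 ↔ Summable fun k => ‖a k‖ ^ 2 := by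
  rw [memℓp_gen_iff (by norm_num)]
  norm_num

lemma memℓp_pow_of_norm_lt_one {w : ℂ} (hw : ‖w‖ < 1) :
    Memℓp (fun k : ℕ => conj w ^ k) 2 := by
  rw [memℓp_two_iff]
  have h : Summable fun k : ℕ => (‖w‖ ^ 2) ^ k :=
    summable_geometric_of_lt_one (by positivity) (by nlinarith [norm_nonneg w])
  refine h.congr fun k => ?_
  rw [norm_pow, RCLike.norm_conj]
  ring

open Classical in
/-- The Szegő kernel at `w`, the element of `H²` reproducing evaluation at `w` (for `‖w‖ < 1`). -/
def szego (w : ℂ) : HardySeq :=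
  if hw : ‖w‖ < 1 then ⟨fun k => conj w ^ k, memℓp_pow_of_norm_lt_one hw⟩ else 0

lemma szego_apply {w : ℂ} (hw : ‖w‖ < 1) (k : ℕ) : szego w k = conj w ^ k := by
  simp [szego, hw]

lemma hasSum_inner_szego {z : ℂ} (hz : ‖z‖ < 1) (x : HardySeq) :
    HasSum (fun k => x k * z ^ k) ⟪szego z, x⟫_ℂ := by
  convert! lp.hasSum_inner (𝕜 := ℂ) (szego z) x using 2 with k
  simp [szego_apply hz]

/-- `f` coincides on the unit disc with the sum of the power series with coefficients `x`. -/
def Represents (f : ℂ → ℂ) (x : HardySeq) : Prop :=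
  ∀ z : ℂ, ‖z‖ < 1 → f z = ⟪szego z, x⟫_ℂ

lemma Represents.hasFPowerSeriesOnBall {f : ℂ → ℂ} {x : HardySeq} (h : Represents f x) :
    HasFPowerSeriesOnBall f (FormalMultilinearSeries.ofScalars ℂ (fun k => x k)) 0 1 := by
  have hsum : ∀ {z : ℂ}, ‖z‖ < 1 → HasSum (fun k => x k * z ^ k) (f z) := fun hz => by
    rw [h _ hz]; exact hasSum_inner_szego hz x
  refine ⟨?_, one_pos, fun {y} hy => ?_⟩
  · refine ENNReal.le_of_forall_nnreal_lt fun r hr => ?_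
    have hr' : ‖((r : ℝ) : ℂ)‖ < 1 := by
      simpa using hr
    refine FormalMultilinearSeries.le_radius_of_summable _ ?_
    refine (hsum hr').summable.norm.congr fun k => ?_
    simp
  · have hy' : ‖y‖ < 1 := by
      simpa [Metric.eball, edist_zero_right, enorm_eq_nnnorm, ← NNReal.coe_lt_coe] using hy
    rw [zero_add]
    convert! hsum hy' using 2 with k
    simp [mul_comm]

lemma Represents.hcoeff_eq {f : ℂ → ℂ} {x : HardySeq} (h : Represents f x) (k : ℕ) :
    hcoeff f k = x k := by
  have h1 := h.hasFPowerSeriesOnBall.hasFPowerSeriesAt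
  have h2 := h1.eq_formalMultilinearSeries h1.analyticAt.hasFPowerSeriesAt
  have h3 := congrArg (fun p => p.coeff k) h2
  simpa [hcoeff] using h3.symm

lemma Represents.differentiableOn {f : ℂ → ℂ} {x : HardySeq} (h : Represents f x) :
    DifferentiableOn ℂ f (ball 0 1) := by
  have := h.hasFPowerSeriesOnBall.differentiableOn
  rwa [← ENNReal.coe_one, Metric.eball_coe] at this

lemma summable_sq (x : HardySeq) : Summable fun k => ‖x k‖ ^ 2 :=
  memℓp_two_iff.1 x.2

lemma HardySeq.norm_sq (x : HardySeq) : ‖x‖ ^ 2 = ∑' k, ‖x k‖ ^ 2 := by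
  have hx := lp.norm_rpow_eq_tsum (p := 2) (by norm_num) x
  norm_num at hx
  exact hx

lemma Represents.memH2 {f : ℂ → ℂ} {x : HardySeq} (h : Represents f x) : MemH2 f :=
  ⟨h.differentiableOn, by simpa only [h.hcoeff_eq] using summable_sq x⟩

lemma MemH2.exists_represents {f : ℂ → ℂ} (h : MemH2 f) : ∃ x, Represents f x := by
  refine ⟨⟨hcoeff f, memℓp_two_iff.2 h.2⟩, fun z hz => ?_⟩
  refine (hasSum_taylorSeries_on_ball h.1 (by simpa using hz)).unique ?_
  convert! hasSum_inner_szego hz ⟨hcoeff f, memℓp_two_iff.2 h.2⟩ using 2 with k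
  simp [hcoeff]
  ring

lemma Represents.h2norm_eq {f : ℂ → ℂ} {x : HardySeq} (h : Represents f x) :
    h2norm f = ‖x‖ := by
  rw [h2norm, Real.sqrt_eq_iff_eq_sq (by positivity) (norm_nonneg x), HardySeq.norm_sq]
  simp only [h.hcoeff_eq]

lemma Represents.h2inner_eq {f g : ℂ → ℂ} {x y : HardySeq} (hf : Represents f x)
    (hg : Represents g y) : h2inner f g = ⟪y, x⟫_ℂ := by
  rw [lp.inner_eq_tsum, h2inner]
  simp only [hf.hcoeff_eq, hg.hcoeff_eq]
  simp

lemma represents_inner_szego (x : HardySeq) : Represents (fun z => ⟪szego z, x⟫_ℂ) x :=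
  fun _ _ => rfl

lemma HardySeq.sub_apply (x y : HardySeq) (k : ℕ) : (x - y) k = x k - y k := rfl

lemma HardySeq.smul_apply (c : ℂ) (x : HardySeq) (k : ℕ) : (c • x) k = c * x k := rfl

/-- The sequence `0, a 0, a 1, …`. -/
def prependZero (a : ℕ → ℂ) : ℕ → ℂ
  | 0 => 0
  | k + 1 => a k

lemma memℓp_prependZero (x : HardySeq) : Memℓp (prependZero x) 2 := by
  rw [memℓp_two_iff, ← summable_nat_add_iff 1]
  exact summable_sq x

/-- Multiplication by `z` on `H²`. -/
def shift : HardySeq →ₗᵢ[ℂ] HardySeq where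
  toFun x := ⟨prependZero x, memℓp_prependZero x⟩
  map_add' x y := by
    ext k
    cases k
    · exact (add_zero (0 : ℂ)).symm
    · rfl
  map_smul' c x := by
    ext k
    cases k
    · exact (mul_zero c).symm
    · rfl
  norm_map' x := by
    rw [← sq_eq_sq₀ (norm_nonneg _) (norm_nonneg _), HardySeq.norm_sq x]
    refine (HardySeq.norm_sq _).trans ?_
    simp only
    rw [Summable.tsum_eq_zero_add]
    · simp [prependZero]
    · exact memℓp_two_iff.1 (memℓp_prependZero x)

@[simp] lemma shift_zero (x : HardySeq) : shift x 0 = 0 := rfl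

@[simp] lemma shift_succ (x : HardySeq) (k : ℕ) : shift x (k + 1) = x k := rfl

lemma inner_szego_shift {z : ℂ} (hz : ‖z‖ < 1) (x : HardySeq) :
    ⟪szego z, shift x⟫_ℂ = z * ⟪szego z, x⟫_ℂ := by
  refine (hasSum_inner_szego hz (shift x)).unique ?_
  rw [← hasSum_nat_add_iff' 1]
  simp only [range_one, sum_singleton, shift_zero, shift_succ, zero_mul, sub_zero]
  convert! (hasSum_inner_szego hz x).mul_left z using 2 with k
  ring

lemma inner_szego_szego {z w : ℂ} (hz : ‖z‖ < 1) (hw : ‖w‖ < 1) :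
    ⟪szego z, szego w⟫_ℂ = (1 - conj w * z)⁻¹ := by
  refine (hasSum_inner_szego hz (szego w)).unique ?_
  have h : ‖conj w * z‖ < 1 := by
    rw [norm_mul, RCLike.norm_conj]
    nlinarith [norm_nonneg w, norm_nonneg z]
  convert! hasSum_geometric_of_norm_lt_one h using 2 with k
  rw [szego_apply hw, mul_pow]

lemma one_sub_conj_mul_ne_zero {z w : ℂ} (hz : ‖z‖ < 1) (hw : ‖w‖ < 1) :
    1 - conj w * z ≠ 0 := by
  intro h
  have h1 : ‖conj w * z‖ = 1 := by rw [← sub_eq_zero.1 h, norm_one]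
  rw [norm_mul, RCLike.norm_conj] at h1
  nlinarith [norm_nonneg w, norm_nonneg z]

/-- The shift as a continuous linear map. -/
abbrev shiftL : HardySeq →L[ℂ] HardySeq := shift.toContinuousLinearMap

lemma isUnit_one_sub_smul {A : HardySeq →L[ℂ] HardySeq} (hA : ‖A‖ ≤ 1) {c : ℂ} (hc : ‖c‖ < 1) :
    IsUnit (1 - c • A) := by
  refine isUnit_one_sub_of_norm_lt_one ?_
  rw [norm_smul]
  nlinarith [norm_nonneg c, norm_nonneg A]

lemma norm_shiftL_le : ‖shiftL‖ ≤ 1 := shift.norm_toContinuousLinearMap_le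

/-- Multiplication by `(1 - conj w * z)⁻¹` on `H²`, for `‖w‖ < 1`. -/
def resolv (w : ℂ) : HardySeq →L[ℂ] HardySeq := Ring.inverse (1 - conj w • shiftL)

lemma resolv_spec {w : ℂ} (hw : ‖w‖ < 1) (x : HardySeq) :
    resolv w x - conj w • shift (resolv w x) = x := by
  have h := Ring.mul_inverse_cancel (1 - conj w • shiftL)
    (isUnit_one_sub_smul norm_shiftL_le (by rwa [RCLike.norm_conj]))
  have := congrArg (fun A => A x) h
  simpa [resolv] using this

lemma resolv_sub {w : ℂ} (hw : ‖w‖ < 1) (x : HardySeq) :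
    resolv w (x - conj w • shift x) = x := by
  have h := Ring.inverse_mul_cancel (1 - conj w • shiftL)
    (isUnit_one_sub_smul norm_shiftL_le (by rwa [RCLike.norm_conj]))
  have := congrArg (fun A => A x) h
  simpa [resolv] using this

lemma inner_szego_resolv {z w : ℂ} (hz : ‖z‖ < 1) (hw : ‖w‖ < 1) (x : HardySeq) :
    ⟪szego z, resolv w x⟫_ℂ = (1 - conj w * z)⁻¹ * ⟪szego z, x⟫_ℂ := by
  have h := one_sub_conj_mul_ne_zero hz hw
  conv_rhs => rw [← resolv_spec hw x]
  rw [inner_sub_right, inner_smul_right, inner_szego_shift hz]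
  field_simp

lemma norm_resolv_le {w : ℂ} (hw : ‖w‖ < 1) (x : HardySeq) :
    ‖resolv w x‖ ≤ ‖x‖ / (1 - ‖w‖) := by
  rw [le_div_iff₀ (by linarith)]
  have h := norm_sub_norm_le (resolv w x) (conj w • shift (resolv w x))
  rw [resolv_spec hw, norm_smul, RCLike.norm_conj, shift.norm_map] at h
  linarith

/-- Multiplication by the Blaschke factor `b_w` on `H²`, for `‖w‖ < 1`. -/
def mulBlaschke (w : ℂ) : HardySeq →ₗ[ℂ] HardySeq :=
  (w • LinearMap.id - shift.toLinearMap) ∘ₗ (resolv w).toLinearMap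

lemma mulBlaschke_apply (w : ℂ) (x : HardySeq) :
    mulBlaschke w x = w • resolv w x - shift (resolv w x) := rfl

lemma inner_szego_mulBlaschke {z w : ℂ} (hz : ‖z‖ < 1) (hw : ‖w‖ < 1) (x : HardySeq) :
    ⟪szego z, mulBlaschke w x⟫_ℂ = blaschke w z * ⟪szego z, x⟫_ℂ := by
  rw [mulBlaschke_apply, inner_sub_right, inner_smul_right, inner_szego_shift hz,
    inner_szego_resolv hz hw, blaschke]
  ring

lemma inner_mulBlaschke {w : ℂ} (hw : ‖w‖ < 1) (x y : HardySeq) :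
    ⟪mulBlaschke w x, mulBlaschke w y⟫_ℂ = ⟪x, y⟫_ℂ := by
  conv_rhs => rw [← resolv_spec hw x, ← resolv_spec hw y]
  simp only [mulBlaschke_apply, inner_sub_left, inner_sub_right, inner_smul_left,
    inner_smul_right, shift.inner_map_map, RCLike.conj_conj]
  ring

lemma norm_mulBlaschke {w : ℂ} (hw : ‖w‖ < 1) (x : HardySeq) : ‖mulBlaschke w x‖ = ‖x‖ := by
  rw [@norm_eq_sqrt_re_inner ℂ, inner_mulBlaschke hw, ← @norm_eq_sqrt_re_inner ℂ]

lemma inner_szego_mulBlaschke_self {w : ℂ} (hw : ‖w‖ < 1) (x : HardySeq) :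
    ⟪szego w, mulBlaschke w x⟫_ℂ = 0 := by
  rw [inner_szego_mulBlaschke hw hw, blaschke]
  simp

lemma adjoint_shiftL_apply (x : HardySeq) (k : ℕ) : shiftL.adjoint x k = x (k + 1) := by
  have h1 : shift (lp.single 2 k (1 : ℂ)) = lp.single 2 (k + 1) (1 : ℂ) := by
    ext j
    cases j with
    | zero => simp [lp.single_apply]
    | succ j => simp [lp.single_apply, Pi.single_apply]
  have h := ContinuousLinearMap.adjoint_inner_right shiftL (lp.single 2 k (1 : ℂ)) x
  simpa [h1, lp.inner_single_left] using h

lemma exists_mulBlaschke_eq {w : ℂ} (hw : ‖w‖ < 1) {x : HardySeq} (hx : ⟪szego w, x⟫_ℂ = 0) :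
    ∃ y, mulBlaschke w y = x := by
  have hA : ‖shiftL.adjoint‖ ≤ 1 := by
    rw [LinearIsometryEquiv.norm_map]
    exact norm_shiftL_le
  obtain ⟨v, hv⟩ : ∃ v, v - w • shiftL.adjoint v = shiftL.adjoint x := by
    refine ⟨Ring.inverse (1 - w • shiftL.adjoint) (shiftL.adjoint x), ?_⟩
    have h := Ring.mul_inverse_cancel _ (isUnit_one_sub_smul hA hw)
    have := congrArg (fun A => A (shiftL.adjoint x)) h
    simpa using this
  have hrec : ∀ k, v k - w * v (k + 1) = x (k + 1) := fun k => by
    have := congrArg (fun u : HardySeq => u k) hv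
    simpa only [HardySeq.sub_apply, HardySeq.smul_apply, adjoint_shiftL_apply] using this
  have hdec : shift v - w • v = x - (x 0 + w * v 0) • szego 0 := by
    ext k
    simp only [HardySeq.sub_apply, HardySeq.smul_apply]
    cases k with
    | zero => simp [szego_apply]
    | succ k =>
      simp only [shift_succ]
      rw [szego_apply (by simp)]
      simp
      linear_combination hrec k
  have h0 : x 0 + w * v 0 = 0 := by
    have := congrArg (fun u => ⟪szego w, u⟫_ℂ) hdec
    simp [inner_szego_shift hw, hx, inner_szego_szego hw]
      at this
    linear_combination this
  refine ⟨-(v - conj w • shift v), ?_⟩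
  rw [mulBlaschke_apply, map_neg, resolv_sub hw, map_neg]
  rw [h0, zero_smul, sub_zero] at hdec
  rw [← hdec]
  module

/-- Multiplication on `H²` by the Blaschke product with the given zeros. -/
def mulBlaschkeProd (l : List ℂ) : Module.End ℂ HardySeq := (l.map mulBlaschke).prod

lemma mulBlaschkeProd_cons (w : ℂ) (l : List ℂ) (x : HardySeq) :
    mulBlaschkeProd (w :: l) x = mulBlaschke w (mulBlaschkeProd l x) := by
  simp [mulBlaschkeProd]

lemma inner_szego_mulBlaschkeProd {z : ℂ} (hz : ‖z‖ < 1) {l : List ℂ} (hl : ∀ w ∈ l, ‖w‖ < 1)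
    (x : HardySeq) :
    ⟪szego z, mulBlaschkeProd l x⟫_ℂ = (l.map fun w => blaschke w z).prod * ⟪szego z, x⟫_ℂ := by
  induction l with
  | nil => simp [mulBlaschkeProd]
  | cons w t ih =>
    rw [mulBlaschkeProd_cons, inner_szego_mulBlaschke hz (hl w (by simp)),
      ih fun v hv => hl v (by simp [hv])]
    simp [mul_assoc]

lemma memKB_iff {m : ℕ} {l : Fin m → ℂ} (hl : ∀ j, ‖l j‖ < 1) {f : ℂ → ℂ} {x : HardySeq}
    (hf : Represents f x) :
    MemKB (fun z => ∏ j, blaschke (l j) z) f ↔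
      ∀ y, ⟪mulBlaschkeProd (List.ofFn l) y, x⟫_ℂ = 0 := by
  have hl' : ∀ w ∈ List.ofFn l, ‖w‖ < 1 := by
    intro w hw
    obtain ⟨j, rfl⟩ := List.mem_ofFn.1 hw
    exact hl j
  have key : ∀ g y, Represents g y →
      Represents (fun z => (∏ j, blaschke (l j) z) * g z) (mulBlaschkeProd (List.ofFn l) y) := by
    intro g y hg z hz
    rw [inner_szego_mulBlaschkeProd hz hl', ← hg z hz, List.map_ofFn, List.prod_ofFn]
    rfl
  constructor
  · intro h y
    rw [← hf.h2inner_eq (key _ y (represents_inner_szego y))]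
    exact h.2 _ (represents_inner_szego y).memH2
  · intro h
    refine ⟨hf.memH2, fun g hg => ?_⟩
    obtain ⟨y, hy⟩ := hg.exists_represents
    rw [hf.h2inner_eq (key g y hy)]
    exact h y

/-- `d` is the derivative of `x` as holomorphic functions on the unit disc. -/
def HasHardyDeriv (x d : HardySeq) : Prop :=
  ∀ z : ℂ, ‖z‖ < 1 → HasDerivAt (fun z => ⟪szego z, x⟫_ℂ) ⟪szego z, d⟫_ℂ z

lemma eventually_norm_lt_one {z : ℂ} (hz : ‖z‖ < 1) : ∀ᶠ u in nhds z, ‖u‖ < 1 :=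
  (isOpen_lt continuous_norm continuous_const).mem_nhds hz

lemma HasHardyDeriv.represents {f : ℂ → ℂ} {x d : HardySeq} (h : HasHardyDeriv x d)
    (hf : Represents f x) : Represents (deriv f) d := fun z hz =>
  ((h z hz).congr_of_eventuallyEq
    ((eventually_norm_lt_one hz).mono fun u hu => hf u hu)).deriv

lemma HasHardyDeriv.add {x y d e : HardySeq} (hx : HasHardyDeriv x d) (hy : HasHardyDeriv y e) :
    HasHardyDeriv (x + y) (d + e) := fun z hz => by
  simpa only [inner_add_right] using (hx z hz).fun_add (hy z hz)

lemma HasHardyDeriv.smul {x d : HardySeq} (hx : HasHardyDeriv x d) (c : ℂ) :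
    HasHardyDeriv (c • x) (c • d) := fun z hz => by
  simpa only [inner_smul_right] using (hx z hz).const_mul c

lemma hasHardyDeriv_zero : HasHardyDeriv 0 0 := fun z _ => by
  simpa only [inner_zero_right] using hasDerivAt_const z (0 : ℂ)

lemma hasHardyDeriv_sum {ι : Type*} {x d : ι → HardySeq} (s : Finset ι)
    (h : ∀ i ∈ s, HasHardyDeriv (x i) (d i)) : HasHardyDeriv (∑ i ∈ s, x i) (∑ i ∈ s, d i) := by
  classical
  induction s using Finset.induction_on with
  | empty => simpa using hasHardyDeriv_zero
  | insert i s hi ih =>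
    rw [sum_insert hi, sum_insert hi]
    exact (h i (by simp)).add (ih fun j hj => h j (by simp [hj]))

lemma hasDerivAt_one_sub_conj_mul (w z : ℂ) :
    HasDerivAt (fun z => 1 - conj w * z) (-conj w) z := by
  simpa using ((hasDerivAt_id z).const_mul (conj w)).const_sub 1

lemma hasDerivAt_blaschke {w z : ℂ} (hz : ‖z‖ < 1) (hw : ‖w‖ < 1) :
    HasDerivAt (blaschke w) (-(1 - w * conj w) / (1 - conj w * z) ^ 2) z := by
  have h := ((hasDerivAt_id z).const_sub w).div (hasDerivAt_one_sub_conj_mul w z)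
    (one_sub_conj_mul_ne_zero hz hw)
  convert! h using 1
  simp
  ring

lemma hasHardyDeriv_szego {w : ℂ} (hw : ‖w‖ < 1) :
    HasHardyDeriv (szego w) (conj w • resolv w (szego w)) := fun z hz => by
  have hne := one_sub_conj_mul_ne_zero hz hw
  have h := (hasDerivAt_one_sub_conj_mul w z).inv hne
  refine HasDerivAt.congr_of_eventuallyEq (f := fun z => (1 - conj w * z)⁻¹) ?_
    ((eventually_norm_lt_one hz).mono fun u hu => inner_szego_szego hu hw)
  convert! h using 1
  rw [inner_smul_right, inner_szego_resolv hz hw, inner_szego_szego hz hw]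
  field_simp

lemma HasHardyDeriv.mulBlaschke {w : ℂ} (hw : ‖w‖ < 1) {x d : HardySeq}
    (hx : HasHardyDeriv x d) :
    HasHardyDeriv (mulBlaschke w x)
      (mulBlaschke w d - (1 - w * conj w) • resolv w (resolv w x)) := fun z hz => by
  have hne := one_sub_conj_mul_ne_zero hz hw
  refine HasDerivAt.congr_of_eventuallyEq (f := fun z => blaschke w z * ⟪szego z, x⟫_ℂ) ?_
    ((eventually_norm_lt_one hz).mono fun u hu => inner_szego_mulBlaschke hu hw x)
  convert! (hasDerivAt_blaschke hz hw).mul (hx z hz) using 1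
  rw [inner_sub_right, inner_smul_right, inner_szego_resolv hz hw, inner_szego_resolv hz hw,
    inner_szego_mulBlaschke hz hw]
  field_simp
  ring

lemma norm_szego_sq {w : ℂ} (hw : ‖w‖ < 1) : ‖szego w‖ ^ 2 = (1 - ‖w‖ ^ 2)⁻¹ := by
  have h := inner_szego_szego hw hw
  rw [inner_self_eq_norm_sq_to_K, RCLike.conj_mul] at h
  apply Complex.ofReal_injective
  push_cast at h ⊢
  exact h

lemma one_sub_mul_conj (w : ℂ) : 1 - w * conj w = ((1 - ‖w‖ ^ 2 : ℝ) : ℂ) := by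
  rw [RCLike.mul_conj]
  push_cast
  rfl

/-- Every element of `K_{b_w B}` is the sum of a multiple of the Szegő kernel at `w` and of
`b_w g` with `g ∈ K_B`. -/
lemma exists_decomposition {w : ℂ} (hw : ‖w‖ < 1) {t : List ℂ} {x : HardySeq}
    (hx : ∀ y, ⟪mulBlaschkeProd (w :: t) y, x⟫_ℂ = 0) :
    ∃ (a : ℂ) (g : HardySeq), x = a • szego w + mulBlaschke w g ∧
      (∀ y, ⟪mulBlaschkeProd t y, g⟫_ℂ = 0) ∧ ‖x‖ ^ 2 = ‖a • szego w‖ ^ 2 + ‖g‖ ^ 2 := by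
  have hne := one_sub_conj_mul_ne_zero hw hw
  set a : ℂ := (1 - conj w * w) * ⟪szego w, x⟫_ℂ with ha
  obtain ⟨g, hg⟩ := exists_mulBlaschke_eq hw (x := x - a • szego w) (by
    rw [inner_sub_right, inner_smul_right, inner_szego_szego hw hw, ha]
    field_simp
    ring)
  have hxg : x = a • szego w + mulBlaschke w g := by rw [hg]; abel
  refine ⟨a, g, hxg, fun y => ?_, ?_⟩
  · rw [← inner_mulBlaschke hw, hg, inner_sub_right, ← mulBlaschkeProd_cons, hx,
      inner_smul_right, mulBlaschkeProd_cons, inner_eq_zero_symm.1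
      (inner_szego_mulBlaschke_self hw _)]
    simp
  · conv_lhs => rw [hxg]
    rw [@norm_add_sq ℂ, inner_smul_left, inner_szego_mulBlaschke_self hw, norm_mulBlaschke hw]
    simp

lemma bernstein_step {ρ r α γ X : ℝ} {m : ℕ} (hρ : 0 ≤ ρ) (hρr : ρ ≤ r) (hr1 : r < 1)
    (hα : 0 ≤ α) (hγ : 0 ≤ γ) (hX : 0 ≤ X) (h : X ^ 2 = α ^ 2 + γ ^ 2) :
    ρ * (α / (1 - ρ)) + (m * ((1 + r) / (1 - r)) + √m * (r / (1 - r))) * γ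
      + (1 - ρ ^ 2) * (γ / (1 - ρ) / (1 - ρ)) ≤
    ((m + 1 : ℕ) * ((1 + r) / (1 - r)) + √(m + 1 : ℕ) * (r / (1 - r))) * X := by
  have hr0 : 0 ≤ r := hρ.trans hρr
  have h1 : ρ * (α / (1 - ρ)) ≤ r / (1 - r) * α := by
    have : ρ / (1 - ρ) ≤ r / (1 - r) := by
      rw [div_le_div_iff₀ (by linarith) (by linarith)]
      nlinarith
    calc ρ * (α / (1 - ρ)) = ρ / (1 - ρ) * α := by ring
      _ ≤ _ := by gcongr
  have h2 : (1 - ρ ^ 2) * (γ / (1 - ρ) / (1 - ρ)) ≤ (1 + r) / (1 - r) * γ := by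
    have h0 : (1 + ρ) / (1 - ρ) ≤ (1 + r) / (1 - r) := by
      rw [div_le_div_iff₀ (by linarith) (by linarith)]
      nlinarith
    have hne : 1 - ρ ≠ 0 := by linarith
    calc (1 - ρ ^ 2) * (γ / (1 - ρ) / (1 - ρ)) = (1 + ρ) / (1 - ρ) * γ := by
          field_simp
          ring
      _ ≤ _ := by gcongr
  have hγX : γ ≤ X := by
    apply le_of_sq_le_sq _ hX
    nlinarith [sq_nonneg α]
  have h3 : α + √m * γ ≤ √(m + 1 : ℕ) * X := by
    apply le_of_sq_le_sq _ (by positivity)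
    have e1 : √(m : ℝ) ^ 2 = m := Real.sq_sqrt (by positivity)
    have e2 : √((m + 1 : ℕ) : ℝ) ^ 2 = m + 1 := by
      rw [Real.sq_sqrt (by positivity)]
      push_cast
      rfl
    rw [mul_pow, e2, h]
    nlinarith [sq_nonneg (√m * α - γ)]
  have hM : 0 ≤ (1 + r) / (1 - r) := div_nonneg (by linarith) (by linarith)
  have hc : 0 ≤ r / (1 - r) := div_nonneg hr0 (by linarith)
  have h4 := mul_le_mul_of_nonneg_left h3 hc
  have h5 : (m + 1) * ((1 + r) / (1 - r)) * γ ≤ (m + 1) * ((1 + r) / (1 - r)) * X := by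
    gcongr
  push_cast at h4 ⊢
  linarith

/-- The Bernstein-type inequality: the derivative of an element of the model space of a finite
Blaschke product, with an explicit bound for its norm. -/
lemma exists_hasHardyDeriv_norm_le {r : ℝ} (hr1 : r < 1) {l : List ℂ} (hl : ∀ w ∈ l, ‖w‖ ≤ r)
    {x : HardySeq} (hx : ∀ y, ⟪mulBlaschkeProd l y, x⟫_ℂ = 0) :
    ∃ d, HasHardyDeriv x d ∧
      ‖d‖ ≤ (l.length * ((1 + r) / (1 - r)) + √l.length * (r / (1 - r))) * ‖x‖ := by
  induction l generalizing x with
  | nil =>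
    have : x = 0 := by simpa [mulBlaschkeProd] using hx x
    exact ⟨0, this ▸ hasHardyDeriv_zero, by simp⟩
  | cons w t ih =>
    have hwr : ‖w‖ ≤ r := hl w (by simp)
    have hw : ‖w‖ < 1 := hwr.trans_lt hr1
    obtain ⟨a, g, rfl, hg, hnorm⟩ := exists_decomposition hw hx
    obtain ⟨e, he, hle⟩ := ih (fun v hv => hl v (by simp [hv])) hg
    refine ⟨_, ((hasHardyDeriv_szego hw).smul a).add (he.mulBlaschke hw), ?_⟩
    refine le_trans ?_ (bernstein_step (m := t.length) (norm_nonneg w) hwr hr1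
      (norm_nonneg (a • szego w)) (norm_nonneg g) (norm_nonneg _) hnorm)
    have h1 : ‖a • conj w • resolv w (szego w)‖ ≤ ‖w‖ * (‖a • szego w‖ / (1 - ‖w‖)) := by
      rw [smul_comm, norm_smul, RCLike.norm_conj, ← map_smul]
      gcongr
      exact norm_resolv_le hw _
    have h2 : ‖(1 - w * conj w) • resolv w (resolv w g)‖ ≤
        (1 - ‖w‖ ^ 2) * (‖g‖ / (1 - ‖w‖) / (1 - ‖w‖)) := by
      have hpos : 0 ≤ 1 - ‖w‖ ^ 2 := by nlinarith [norm_nonneg w]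
      rw [norm_smul, one_sub_mul_conj, Complex.norm_real, Real.norm_of_nonneg hpos]
      gcongr
      refine (norm_resolv_le hw _).trans ?_
      have : 0 ≤ 1 - ‖w‖ := by linarith
      gcongr
      exact norm_resolv_le hw _
    refine (norm_add_le _ _).trans ?_
    have h3 := norm_sub_le (mulBlaschke w e) ((1 - w * conj w) • resolv w (resolv w g))
    rw [norm_mulBlaschke hw] at h3
    linarith

lemma inner_self_szego_mulBlaschke_pow {w : ℂ} (hw : ‖w‖ < 1) {k : ℕ} (hk : k ≠ 0)
    (x : HardySeq) : ⟪(mulBlaschke w ^ k) x, szego w⟫_ℂ = 0 := by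
  obtain ⟨k, rfl⟩ := Nat.exists_eq_succ_of_ne_zero hk
  rw [pow_succ', Module.End.mul_apply, inner_eq_zero_symm]
  exact inner_szego_mulBlaschke_self hw _

lemma inner_mulBlaschke_pow {w : ℂ} (hw : ‖w‖ < 1) (k : ℕ) (x y : HardySeq) :
    ⟪(mulBlaschke w ^ k) x, (mulBlaschke w ^ k) y⟫_ℂ = ⟪x, y⟫_ℂ := by
  induction k with
  | zero => simp
  | succ k ih => rw [pow_succ', Module.End.mul_apply, Module.End.mul_apply,
      inner_mulBlaschke hw, ih]

lemma inner_szego_mulBlaschke_pow {z w : ℂ} (hz : ‖z‖ < 1) (hw : ‖w‖ < 1) (k : ℕ)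
    (x : HardySeq) :
    ⟪szego z, (mulBlaschke w ^ k) x⟫_ℂ = blaschke w z ^ k * ⟪szego z, x⟫_ℂ := by
  induction k with
  | zero => simp
  | succ k ih =>
    rw [pow_succ', Module.End.mul_apply, inner_szego_mulBlaschke hz hw, ih]
    ring

/-- The Malmquist–Walsh basis of `K_{b_r^n}`, indexed from `0`. -/
def malmquist (r : ℝ) (k : ℕ) : HardySeq :=
  (√(1 - r ^ 2) : ℂ) • (mulBlaschke (r : ℂ) ^ k) (szego r)

lemma orthonormal_malmquist {r : ℝ} (hr0 : 0 ≤ r) (hr1 : r < 1) :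
    Orthonormal ℂ (malmquist r) := by
  have hw : ‖(r : ℂ)‖ < 1 := by simpa [abs_of_nonneg hr0] using hr1
  have hpos : 0 < 1 - r ^ 2 := by nlinarith
  have hlt : ∀ i j, i < j → ⟪malmquist r j, malmquist r i⟫_ℂ = 0 := by
    intro i j hij
    obtain ⟨k, rfl⟩ := Nat.exists_eq_add_of_lt hij
    rw [malmquist, malmquist, inner_smul_left, inner_smul_right, add_assoc, pow_add,
      Module.End.mul_apply, inner_mulBlaschke_pow hw,
      inner_self_szego_mulBlaschke_pow hw (Nat.succ_ne_zero k)]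
    simp
  refine ⟨fun i => ?_, fun i j hij => ?_⟩
  · have h : ‖(mulBlaschke (r : ℂ) ^ i) (szego r)‖ = ‖szego r‖ := by
      rw [@norm_eq_sqrt_re_inner ℂ, inner_mulBlaschke_pow hw, ← @norm_eq_sqrt_re_inner ℂ]
    rw [malmquist, norm_smul, h, ← sq_eq_sq₀ (by positivity) zero_le_one, mul_pow,
      norm_szego_sq hw, Complex.norm_real, Complex.norm_real, Real.norm_eq_abs, Real.norm_eq_abs,
      sq_abs, sq_abs, Real.sq_sqrt hpos.le, one_pow]
    exact mul_inv_cancel₀ hpos.ne'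
  · rcases lt_or_gt_of_ne hij with h | h
    · rw [inner_eq_zero_symm]
      exact hlt i j h
    · exact hlt j i h

/-- Differentiation acts on the Malmquist–Walsh basis as a three-term recurrence. -/
lemma hasHardyDeriv_malmquist {r : ℝ} (hr0 : 0 ≤ r) (hr1 : r < 1) (k : ℕ) :
    HasHardyDeriv (malmquist r k) ((1 - r ^ 2 : ℂ)⁻¹ • (((2 * k + 1) * r : ℂ) • malmquist r k
      - (k : ℂ) • malmquist r (k - 1) - (r ^ 2 * (k + 1) : ℂ) • malmquist r (k + 1))) := by
  intro z hz
  have hw : ‖(r : ℂ)‖ < 1 := by simpa [abs_of_nonneg hr0] using hr1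
  have hr2 : (1 - r ^ 2 : ℂ) ≠ 0 := by
    have : (1 - r ^ 2 : ℝ) ≠ 0 := by nlinarith
    exact_mod_cast this
  have hval : ∀ {u : ℂ}, ‖u‖ < 1 → ∀ j, ⟪szego u, malmquist r j⟫_ℂ =
      √(1 - r ^ 2) * (blaschke r u ^ j * (1 - r * u)⁻¹) := by
    intro u hu j
    rw [malmquist, inner_smul_right, inner_szego_mulBlaschke_pow hu hw, inner_szego_szego hu hw,
      Complex.conj_ofReal]
  have hne : (1 - r * z : ℂ) ≠ 0 := by
    simpa using one_sub_conj_mul_ne_zero hz hw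
  refine HasDerivAt.congr_of_eventuallyEq
    (f := fun u => (√(1 - r ^ 2) : ℂ) * (blaschke r u ^ k * (1 - r * u)⁻¹)) ?_
    ((eventually_norm_lt_one hz).mono fun u hu => hval hu k)
  have hb := hasDerivAt_blaschke hz hw
  have hd := hasDerivAt_one_sub_conj_mul (r : ℂ) z
  rw [Complex.conj_ofReal] at hb hd
  convert! (((hb.fun_pow k).mul (hd.inv hne)).const_mul (√(1 - r ^ 2) : ℂ)) using 1
  have hbz : blaschke r z * (1 - r * z) = r - z := by
    rw [blaschke, Complex.conj_ofReal]
    field_simp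
  simp only [inner_smul_right, inner_sub_right, hval hz]
  set b := blaschke (r : ℂ) z
  have hinv : (1 - r * z : ℂ)⁻¹ = (1 - r * b) / (1 - r ^ 2) := by
    rw [inv_eq_one_div, div_eq_div_iff hne hr2]
    linear_combination (r : ℂ) * hbz
  have hdiv : ∀ c : ℂ, c / (1 - r * z) ^ 2 = c * ((1 - r * b) / (1 - r ^ 2)) ^ 2 := fun c => by
    rw [← hinv, div_eq_mul_inv, inv_pow]
  simp only [Pi.inv_apply, hdiv, hinv]
  cases k with
  | zero =>
    simp
    field_simp
  | succ k =>
    simp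
    field_simp
    ring

lemma mulBlaschkeProd_replicate (n : ℕ) (w : ℂ) :
    mulBlaschkeProd (List.replicate n w) = mulBlaschke w ^ n := by
  simp [mulBlaschkeProd]

lemma inner_mulBlaschke_pow_malmquist {r : ℝ} (hr0 : 0 ≤ r) (hr1 : r < 1) {k n : ℕ} (hk : k < n)
    (y : HardySeq) : ⟪(mulBlaschke (r : ℂ) ^ n) y, malmquist r k⟫_ℂ = 0 := by
  have hw : ‖(r : ℂ)‖ < 1 := by simpa [abs_of_nonneg hr0] using hr1
  obtain ⟨j, rfl⟩ := Nat.exists_eq_add_of_lt hk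
  rw [malmquist, inner_smul_right, add_assoc, pow_add, Module.End.mul_apply,
    inner_mulBlaschke_pow hw, inner_self_szego_mulBlaschke_pow hw (Nat.succ_ne_zero j), mul_zero]

/-- The alternating sum of the last `s` elements of the basis of `K_{b_r^{A+s}}`, whose derivative
is large. -/
lemma exists_norm_deriv_ge {r : ℝ} (hr0 : 0 ≤ r) (hr1 : r < 1) {A s : ℕ} (hA : 1 ≤ A) :
    ∃ x d, HasHardyDeriv x d ∧ (∀ y, ⟪(mulBlaschke (r : ℂ) ^ (A + s)) y, x⟫_ℂ = 0) ∧
      ‖x‖ ^ 2 = s ∧ (s - 2) * (A * ((1 + r) / (1 - r))) ^ 2 ≤ ‖d‖ ^ 2 := by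
  have hon := orthonormal_malmquist hr0 hr1
  have hr2 : 0 < 1 - r ^ 2 := by nlinarith
  refine ⟨_, _, hasHardyDeriv_sum (Ico A (A + s)) (fun i _ =>
    (hasHardyDeriv_malmquist hr0 hr1 i).smul ((-1) ^ i)), fun y => ?_, ?_, ?_⟩
  · rw [inner_sum]
    refine sum_eq_zero fun i hi => ?_
    rw [inner_smul_right, inner_mulBlaschke_pow_malmquist hr0 hr1 (mem_Ico.1 hi).2, mul_zero]
  · have h := hon.inner_sum (fun i => (-1) ^ i) (fun i => (-1) ^ i) (Ico A (A + s))
    rw [inner_self_eq_norm_sq_to_K] at h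
    apply Complex.ofReal_injective
    push_cast
    refine h.trans ?_
    simp [← mul_pow]
  · set d := ∑ i ∈ Ico A (A + s), (-1 : ℂ) ^ i • ((1 - r ^ 2 : ℂ)⁻¹ •
      (((2 * i + 1) * r : ℂ) • malmquist r i - (i : ℂ) • malmquist r (i - 1)
        - (r ^ 2 * (i + 1) : ℂ) • malmquist r (i + 1))) with hd
    have hite := orthonormal_iff_ite.1 hon
    have hcoef : ∀ i ∈ Ico (A + 1) (A + s - 1), ⟪malmquist r i, d⟫_ℂ =
        (-1) ^ i * ((((i + 1) + (2 * i + 1) * r + r ^ 2 * i) / (1 - r ^ 2) : ℝ) : ℂ) := by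
      intro i hi
      rw [mem_Ico] at hi
      have e1 : ∀ j ∈ Ico A (A + s), (i = j - 1 ↔ j = i + 1) := fun j hj => by
        rw [mem_Ico] at hj
        omega
      obtain ⟨k, rfl⟩ : ∃ k, i = k + 1 := ⟨i - 1, by omega⟩
      have h1 : k ∈ Ico A (A + s) := mem_Ico.2 (by omega)
      have h2 : k + 1 ∈ Ico A (A + s) := mem_Ico.2 (by omega)
      have h3 : k + 1 + 1 ∈ Ico A (A + s) := mem_Ico.2 (by omega)
      rw [hd, inner_sum]
      simp only [inner_smul_right, inner_sub_right, hite]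
      rw [sum_congr rfl fun j hj => by
        rw [if_congr (e1 j hj) rfl rfl, if_congr (Nat.succ_inj (a := k) (b := j)) rfl rfl]]
      simp only [mul_sub, sum_sub_distrib, mul_ite, mul_zero, mul_one, sum_ite_eq, sum_ite_eq', h1,
        h2, h3, if_true]
      push_cast
      ring
    have hbound : ∀ i ∈ Ico (A + 1) (A + s - 1),
        (A * ((1 + r) / (1 - r))) ^ 2 ≤ ‖⟪malmquist r i, d⟫_ℂ‖ ^ 2 := by
      intro i hi
      have hAi : (A : ℝ) ≤ i := by
        rw [mem_Ico] at hi
        exact_mod_cast (by omega : A ≤ i)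
      have hnum : (A : ℝ) * (1 + r) ^ 2 ≤ (i + 1) + (2 * i + 1) * r + r ^ 2 * i := by
        nlinarith [mul_le_mul_of_nonneg_right hAi (sq_nonneg (1 + r))]
      have hM : (A : ℝ) * ((1 + r) / (1 - r)) = A * (1 + r) ^ 2 / (1 - r ^ 2) := by
        have : 1 - r ≠ 0 := by linarith
        have := hr2.ne'
        field_simp
        ring
      have hM0 : 0 ≤ (A : ℝ) * ((1 + r) / (1 - r)) :=
        mul_nonneg (by positivity) (div_nonneg (by linarith) (by linarith))
      have hle : (A : ℝ) * ((1 + r) / (1 - r)) ≤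
          ((i + 1) + (2 * i + 1) * r + r ^ 2 * i) / (1 - r ^ 2) := by
        rw [hM]
        gcongr
      rw [hcoef i hi, norm_mul, norm_pow, norm_neg, norm_one, one_pow, one_mul, Complex.norm_real,
        Real.norm_of_nonneg (hM0.trans hle)]
      gcongr
    calc (s - 2) * (A * ((1 + r) / (1 - r))) ^ 2
        ≤ #(Ico (A + 1) (A + s - 1)) * (A * ((1 + r) / (1 - r))) ^ 2 := by
          gcongr
          rw [Nat.card_Ico, sub_le_iff_le_add]
          exact_mod_cast (by omega : s ≤ A + s - 1 - (A + 1) + 2)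
      _ ≤ ∑ i ∈ Ico (A + 1) (A + s - 1), ‖⟪malmquist r i, d⟫_ℂ‖ ^ 2 := by
          rw [← nsmul_eq_mul]
          exact card_nsmul_le_sum _ _ _ hbound
      _ ≤ ‖d‖ ^ 2 := hon.sum_inner_products_le d

/-- The constant of the Bernstein-type inequality in degree `n`. -/
def bernsteinConst (n : ℕ) (r : ℝ) : ℝ := n * ((1 + r) / (1 - r)) + √n * (r / (1 - r))

lemma bernsteinConst_nonneg {r : ℝ} (hr0 : 0 ≤ r) (hr1 : r < 1) (n : ℕ) :
    0 ≤ bernsteinConst n r := by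
  have hM : 0 ≤ (1 + r) / (1 - r) := div_nonneg (by linarith) (by linarith)
  have hc : 0 ≤ r / (1 - r) := div_nonneg hr0 (by linarith)
  unfold bernsteinConst
  positivity

lemma bernsteinConst_mono {r : ℝ} (hr0 : 0 ≤ r) (hr1 : r < 1) {m n : ℕ} (h : m ≤ n) :
    bernsteinConst m r ≤ bernsteinConst n r := by
  have hM : 0 ≤ (1 + r) / (1 - r) := div_nonneg (by linarith) (by linarith)
  have hc : 0 ≤ r / (1 - r) := div_nonneg hr0 (by linarith)
  unfold bernsteinConst
  gcongr

lemma h2norm_deriv_le {r : ℝ} (hr0 : 0 ≤ r) (hr1 : r < 1) {m : ℕ} {l : Fin m → ℂ}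
    (hl : ∀ j, ‖l j‖ ≤ r) {f : ℂ → ℂ} (hf : MemKB (fun z => ∏ j, blaschke (l j) z) f)
    (hf1 : h2norm f ≤ 1) : h2norm (deriv f) ≤ bernsteinConst m r := by
  obtain ⟨x, hx⟩ := hf.1.exists_represents
  have hl' : ∀ w ∈ List.ofFn l, ‖w‖ ≤ r := by
    intro w hw
    obtain ⟨j, rfl⟩ := List.mem_ofFn.1 hw
    exact hl j
  obtain ⟨d, hd, hle⟩ := exists_hasHardyDeriv_norm_le hr1 hl'
    ((memKB_iff (fun j => (hl j).trans_lt hr1) hx).1 hf)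
  rw [hx.h2norm_eq] at hf1
  rw [(hd.represents hx).h2norm_eq]
  rw [List.length_ofFn] at hle
  exact hle.trans (mul_le_of_le_one_right (bernsteinConst_nonneg hr0 hr1 m) hf1)

lemma DNorm_le {r : ℝ} (hr0 : 0 ≤ r) (hr1 : r < 1) {m : ℕ} {l : Fin m → ℂ}
    (hl : ∀ j, ‖l j‖ ≤ r) : DNorm (fun z => ∏ j, blaschke (l j) z) ≤ bernsteinConst m r := by
  refine Real.sSup_le ?_ (bernsteinConst_nonneg hr0 hr1 m)
  rintro _ ⟨f, hf, hf1, rfl⟩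
  exact h2norm_deriv_le hr0 hr1 hl hf hf1

lemma norm_le_DNorm {r : ℝ} (hr0 : 0 ≤ r) (hr1 : r < 1) {m : ℕ} {l : Fin m → ℂ}
    (hl : ∀ j, ‖l j‖ ≤ r) {x d : HardySeq} (hd : HasHardyDeriv x d) (hx1 : ‖x‖ ≤ 1)
    (hx : ∀ y, ⟪mulBlaschkeProd (List.ofFn l) y, x⟫_ℂ = 0) :
    ‖d‖ ≤ DNorm (fun z => ∏ j, blaschke (l j) z) := by
  have hr := represents_inner_szego x
  refine le_csSup ⟨bernsteinConst m r, ?_⟩ ⟨_, (memKB_iff (fun j => (hl j).trans_lt hr1) hr).2 hx,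
    hr.h2norm_eq.trans_le hx1, (hd.represents hr).h2norm_eq.symm⟩
  rintro _ ⟨f, hf, hf1, rfl⟩
  exact h2norm_deriv_le hr0 hr1 hl hf hf1

lemma Cnr_le {r : ℝ} (hr0 : 0 ≤ r) (hr1 : r < 1) (n : ℕ) : Cnr n r ≤ bernsteinConst n r := by
  refine Real.sSup_le ?_ (bernsteinConst_nonneg hr0 hr1 n)
  rintro _ ⟨m, -, hmn, l, hl, rfl⟩
  exact (DNorm_le hr0 hr1 hl).trans (bernsteinConst_mono hr0 hr1 hmn)

lemma DNorm_le_Cnr {r : ℝ} (hr0 : 0 ≤ r) (hr1 : r < 1) {n : ℕ} (hn : 1 ≤ n) {l : Fin n → ℂ}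
    (hl : ∀ j, ‖l j‖ ≤ r) : DNorm (fun z => ∏ j, blaschke (l j) z) ≤ Cnr n r := by
  refine le_csSup ⟨bernsteinConst n r, ?_⟩ ⟨n, hn, le_rfl, l, hl, rfl⟩
  rintro _ ⟨m, -, hmn, l, hl, rfl⟩
  exact (DNorm_le hr0 hr1 hl).trans (bernsteinConst_mono hr0 hr1 hmn)

lemma le_Cnr {r : ℝ} (hr0 : 0 ≤ r) (hr1 : r < 1) {A s : ℕ} (hA : 1 ≤ A) (hs : 2 ≤ s) :
    (1 - 2 / s) * (A * ((1 + r) / (1 - r))) ≤ Cnr (A + s) r := by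
  obtain ⟨x, d, hd, hx, hxs, hds⟩ := exists_norm_deriv_ge hr0 hr1 (s := s) hA
  have hs' : (2 : ℝ) ≤ s := by exact_mod_cast hs
  have hs0 : 0 < √(s : ℝ) := Real.sqrt_pos.2 (by linarith)
  have hxn : ‖x‖ = √(s : ℝ) := by rw [← hxs, Real.sqrt_sq (norm_nonneg x)]
  have hw : ‖(r : ℂ)‖ ≤ r := by simp [abs_of_nonneg hr0]
  have hnorm : ‖((√(s : ℝ))⁻¹ : ℂ)‖ = (√(s : ℝ))⁻¹ := by
    rw [norm_inv, Complex.norm_real, Real.norm_of_nonneg hs0.le]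
  have key := norm_le_DNorm hr0 hr1 (l := fun _ : Fin (A + s) => (r : ℂ)) (fun _ => hw)
    (hd.smul ((√(s : ℝ))⁻¹ : ℂ))
    (by rw [norm_smul, hnorm, hxn, inv_mul_cancel₀ hs0.ne'])
    (fun y => by
      rw [List.ofFn_const, mulBlaschkeProd_replicate, inner_smul_right, hx, mul_zero])
  refine le_trans ?_ (key.trans (DNorm_le_Cnr hr0 hr1 (by omega) fun _ => hw))
  apply le_of_sq_le_sq _ (norm_nonneg _)
  have h1 : (0 : ℝ) ≤ 1 - 2 / s := by
    rw [sub_nonneg, div_le_one (by linarith)]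
    exact hs'
  have h2 : (1 - 2 / s : ℝ) ≤ 1 := by
    have : (0 : ℝ) ≤ 2 / s := by positivity
    linarith
  rw [norm_smul, hnorm, mul_pow, mul_pow _ ‖d‖, inv_pow, Real.sq_sqrt (by linarith)]
  calc (1 - 2 / s : ℝ) ^ 2 * (A * ((1 + r) / (1 - r))) ^ 2
      ≤ (1 - 2 / s : ℝ) * (A * ((1 + r) / (1 - r))) ^ 2 := by
        gcongr
        exact pow_le_of_le_one h1 h2 two_ne_zero
    _ = (s : ℝ)⁻¹ * ((s - 2) * (A * ((1 + r) / (1 - r))) ^ 2) := by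
        field_simp
    _ ≤ _ := by gcongr

lemma tendsto_inv_natSqrt : Tendsto (fun n : ℕ => ((n.sqrt : ℝ))⁻¹) atTop (nhds 0) := by
  refine tendsto_inv_atTop_zero.comp (tendsto_natCast_atTop_atTop.comp ?_)
  refine tendsto_atTop.2 fun b => ?_
  filter_upwards [eventually_ge_atTop (b * b)] with n hn
  exact Nat.le_sqrt.2 hn

/-- For every `r ∈ [0,1)`, the sequence `(C_{n,r}/n)_{n≥1}` converges
and `lim_{n→∞} C_{n,r}/n = (1+r)/(1-r)`. -/
theorem stmt3 (r : ℝ) (hr0 : 0 ≤ r) (hr1 : r < 1) :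
    Tendsto (fun n : ℕ => Cnr n r / n) atTop (nhds ((1 + r) / (1 - r))) := by
  set M : ℝ := (1 + r) / (1 - r) with hM
  have hM0 : 0 ≤ M := div_nonneg (by linarith) (by linarith)
  have hupper : Tendsto (fun n : ℕ => M + (√(n : ℝ))⁻¹ * (r / (1 - r))) atTop (nhds M) := by
    have h : Tendsto (fun n : ℕ => (√(n : ℝ))⁻¹) atTop (nhds 0) :=
      tendsto_inv_atTop_zero.comp (Real.tendsto_sqrt_atTop.comp tendsto_natCast_atTop_atTop)
    simpa using (h.mul_const (r / (1 - r))).const_add M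
  have hlower : Tendsto (fun n : ℕ => (1 - 2 * (n.sqrt : ℝ)⁻¹) * ((1 - (n.sqrt : ℝ)⁻¹) * M))
      atTop (nhds M) := by
    have h := tendsto_inv_natSqrt
    simpa using ((h.const_mul 2).const_sub 1).mul ((h.const_sub 1).mul_const M)
  refine tendsto_of_tendsto_of_tendsto_of_le_of_le' hlower hupper ?_ ?_
  · filter_upwards [eventually_ge_atTop 4] with n hn
    have hs2 : 2 ≤ n.sqrt := Nat.le_sqrt.2 hn
    have hss : n.sqrt * n.sqrt ≤ n := Nat.sqrt_le n
    have hlt : n.sqrt < n := by nlinarith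
    have h := le_Cnr hr0 hr1 (A := n - n.sqrt) (s := n.sqrt) (by omega) hs2
    rw [Nat.sub_add_cancel hlt.le, Nat.cast_sub hlt.le, ← hM] at h
    have hs2' : (2 : ℝ) ≤ n.sqrt := by exact_mod_cast hs2
    have hss' : (n.sqrt : ℝ) * n.sqrt ≤ n := by exact_mod_cast hss
    have hn0 : (0 : ℝ) < n := by exact_mod_cast (by omega : 0 < n)
    have h1 : (0 : ℝ) ≤ 1 - 2 / n.sqrt := by
      rw [sub_nonneg, div_le_one (by linarith)]
      exact hs2'
    rw [le_div_iff₀ hn0]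
    refine le_trans ?_ h
    rw [← div_eq_mul_inv, mul_assoc, mul_right_comm _ M]
    gcongr
    rw [sub_mul, one_mul]
    gcongr
    rw [inv_mul_eq_div, le_div_iff₀ (by linarith)]
    exact hss'
  · filter_upwards [eventually_ge_atTop 1] with n hn
    have hn0 : (0 : ℝ) < n := by exact_mod_cast hn
    rw [div_le_iff₀ hn0]
    refine (Cnr_le hr0 hr1 n).trans (le_of_eq ?_)
    have hsq : √(n : ℝ) * √(n : ℝ) = n := Real.mul_self_sqrt hn0.le
    have hne : √(n : ℝ) ≠ 0 := (Real.sqrt_pos.2 hn0).ne'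
    rw [bernsteinConst, ← hM]
    have : (√(n : ℝ))⁻¹ * n = √(n : ℝ) := by
      rw [inv_mul_eq_iff_eq_mul₀ hne, hsq]
    linear_combination -(r / (1 - r)) * this
end
end

section
/- Let n ≥ 2, 0 ≤ r < 1, b_r(z) = (r-z)/(1-rz), and e_n(z) = (1-r²)^{1/2}/(1-rz) · b_r(z)^{n-1}. Then ‖e_n'‖₂² = ((n-1)² + (2n-1)²·r² + n²·r⁴)/(1-r²)². -/
open Complex Filter Finset MeasureTheory Metric

noncomputable section

lemma h2norm_sq (f : ℂ → ℂ) : h2norm f ^ 2 = ∑' k : ℕ, ‖hcoeff f k‖ ^ 2 :=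
  Real.sq_sqrt (tsum_nonneg fun _ => by positivity)

lemma hcoeff_congr {f g : ℂ → ℂ} (h : f =ᶠ[nhds 0] g) : hcoeff f = hcoeff g := by
  funext k
  rw [hcoeff, hcoeff, h.iteratedDeriv_eq]

lemma h2norm_congr {f g : ℂ → ℂ} (h : f =ᶠ[nhds 0] g) : h2norm f = h2norm g := by
  rw [h2norm, h2norm, hcoeff_congr h]

lemma hcoeff_zero (f : ℂ → ℂ) : hcoeff f 0 = f 0 := by
  simp [hcoeff]

lemma summable_norm_hcoeff_sq {f : ℂ → ℂ} {R : ℝ} (hR : 1 < R)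
    (hf : DifferentiableOn ℂ f (ball 0 R)) : Summable fun k => ‖hcoeff f k‖ ^ 2 := by
  have h1 : (1 : ℂ) ∈ ball (0 : ℂ) R := by simpa using hR
  have h := (Complex.hasSum_taylorSeries_on_ball hf h1).summable.norm
  have h' : Summable fun k => ‖hcoeff f k‖ := by
    refine h.congr fun k => ?_
    simp [hcoeff, div_eq_inv_mul]
  refine h'.of_norm_bounded_eventually_nat ?_
  filter_upwards [h'.tendsto_atTop_zero.eventually_le_const one_pos] with k hk
  rw [Real.norm_of_nonneg (by positivity)]
  nlinarith [norm_nonneg (hcoeff f k)]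

lemma iteratedDeriv_affine (a b : ℂ) (i : ℕ) :
    iteratedDeriv i (fun z : ℂ => a + b * z) 0 = if i = 0 then a else if i = 1 then b else 0 := by
  have hd : deriv (fun z : ℂ => a + b * z) = fun _ => b := by
    funext z
    simp
  rcases i with _ | i
  · simp
  · rw [iteratedDeriv_succ', hd, iteratedDeriv_const]
    simp

/-- Taylor coefficients of the product of an analytic function with an affine function. -/
lemma hcoeff_affine_mul_succ {f : ℂ → ℂ} (hf : AnalyticAt ℂ f 0) (a b : ℂ) (k : ℕ) :
    hcoeff (fun z => (a + b * z) * f z) (k + 1) = a * hcoeff f (k + 1) + b * hcoeff f k := by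
  have hm := iteratedDeriv_mul (n := k + 1) (x := (0 : ℂ)) (f := fun z : ℂ => a + b * z) (g := f)
    (by fun_prop) hf.contDiffAt
  have hk : ((k : ℂ) + 1) ≠ 0 := by exact_mod_cast k.succ_ne_zero
  have hk' : ((k.factorial : ℕ) : ℂ) ≠ 0 := by exact_mod_cast k.factorial_ne_zero
  have he : (fun z => (a + b * z) * f z) = (fun z : ℂ => a + b * z) * f := rfl
  rw [hcoeff, he, hm, Finset.sum_range_succ', Finset.sum_range_succ']
  simp only [iteratedDeriv_affine, hcoeff, Nat.factorial_succ]
  simp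
  field_simp
  ring

/-- Multiplication by `r - z` and multiplication by `1 - r z` yield the same `H²` norm. -/
lemma h2norm_blaschke_numerator_eq {f : ℂ → ℂ} {R : ℝ} (hR : 1 < R)
    (hf : DifferentiableOn ℂ f (ball 0 R)) (r : ℝ) :
    h2norm (fun z => (r + (-1) * z) * f z) = h2norm (fun z => (1 + (-r) * z) * f z) := by
  have hfa : AnalyticAt ℂ f 0 := hf.analyticAt (ball_mem_nhds _ (by linarith))
  have s0 := summable_norm_hcoeff_sq hR hf
  have s1 : Summable fun k => ‖hcoeff (fun z => (r + (-1) * z) * f z) k‖ ^ 2 :=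
    summable_norm_hcoeff_sq hR (by fun_prop)
  have s2 : Summable fun k => ‖hcoeff (fun z => (1 + (-r) * z) * f z) k‖ ^ 2 :=
    summable_norm_hcoeff_sq hR (by fun_prop)
  have key : ∀ u v : ℂ, ‖(r : ℂ) * u + (-1) * v‖ ^ 2 =
      ‖1 * u + (-(r : ℂ)) * v‖ ^ 2 + (1 - r ^ 2) * (‖v‖ ^ 2 - ‖u‖ ^ 2) := by
    intro u v
    simp only [Complex.sq_norm, Complex.normSq_apply]
    simp
    ring
  rw [h2norm, h2norm]
  congr 1
  rw [s1.tsum_eq_zero_add, s2.tsum_eq_zero_add]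
  simp only [hcoeff_affine_mul_succ hfa, key]
  have s2' : Summable fun k =>
      ‖1 * hcoeff f (k + 1) + (-(r : ℂ)) * hcoeff f k‖ ^ 2 := by
    simpa only [hcoeff_affine_mul_succ hfa] using (summable_nat_add_iff 1).2 s2
  have s0' := (summable_nat_add_iff 1).2 s0
  rw [s2'.tsum_add ((s0.sub s0').mul_left _), tsum_mul_left, s0.tsum_sub s0',
    s0.tsum_eq_zero_add]
  simp only [hcoeff_zero]
  simp [mul_pow]
  ring

lemma one_sub_mul_ne_zero {r : ℝ} (hr0 : 0 ≤ r) (hr1 : r < 1) {z : ℂ}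
    (hz : z ∈ ball (0 : ℂ) (2 / (1 + r))) : 1 + (-r : ℂ) * z ≠ 0 := by
  intro h
  have h1 : (r : ℂ) * z = 1 := by linear_combination -h
  have h2 : r * ‖z‖ = 1 := by
    have := congrArg norm h1
    simpa [abs_of_nonneg hr0] using this
  have hz' : ‖z‖ < 2 / (1 + r) := by simpa using hz
  rw [lt_div_iff₀ (by linarith)] at hz'
  nlinarith [norm_nonneg z]

lemma one_lt_two_div {r : ℝ} (hr0 : 0 ≤ r) (hr1 : r < 1) : 1 < 2 / (1 + r) := by
  rw [lt_div_iff₀ (by linarith)]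
  linarith

/-- Multiplication by powers of the Blaschke factor preserves the `H²` norm. -/
lemma h2norm_blaschke_pow_mul {r : ℝ} (hr0 : 0 ≤ r) (hr1 : r < 1) {f : ℂ → ℂ}
    (hf : DifferentiableOn ℂ f (ball 0 (2 / (1 + r)))) (j : ℕ) :
    h2norm (fun z => (r + (-1) * z) ^ j * ((1 + (-r) * z)⁻¹) ^ j * f z) = h2norm f := by
  have hR := one_lt_two_div hr0 hr1
  induction j with
  | zero => simp
  | succ j ih =>
    have hinv : DifferentiableOn ℂ (fun z : ℂ => (1 + (-r : ℂ) * z)⁻¹) (ball 0 (2 / (1 + r))) :=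
      DifferentiableOn.inv (by fun_prop) fun z hz => one_sub_mul_ne_zero hr0 hr1 hz
    have hu : DifferentiableOn ℂ
        (fun z : ℂ => (r + (-1) * z) ^ j * ((1 + (-r : ℂ) * z)⁻¹) ^ (j + 1) * f z)
        (ball 0 (2 / (1 + r))) :=
      ((DifferentiableOn.pow (by fun_prop) j).mul (hinv.pow (j + 1))).mul hf
    have hb := h2norm_blaschke_numerator_eq hR hu r
    rw [← ih]
    convert! hb using 1
    · congr 1
      funext z
      ring
    · refine h2norm_congr ?_
      filter_upwards [ball_mem_nhds (0 : ℂ) (by linarith : 0 < 2 / (1 + r))] with z hz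
      have := mul_inv_cancel₀ (one_sub_mul_ne_zero hr0 hr1 hz)
      linear_combination -((r + (-1) * z) ^ j * ((1 + (-r : ℂ) * z)⁻¹) ^ j * f z) * this

lemma hcoeff_const_one (k : ℕ) : hcoeff (fun _ => 1) k = if k = 0 then 1 else 0 := by
  rw [hcoeff, iteratedDeriv_const]
  split_ifs with h
  · simp [h]
  · simp

lemma analyticAt_inv_pow (r : ℝ) (m : ℕ) :
    AnalyticAt ℂ (fun z : ℂ => ((1 + (-r) * z)⁻¹) ^ m) 0 := by
  refine AnalyticAt.pow (AnalyticAt.inv (by fun_prop) (by simp)) m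

lemma hcoeff_inv_pow_succ (r : ℝ) (m k : ℕ) :
    hcoeff (fun z : ℂ => ((1 + (-r) * z)⁻¹) ^ (m + 1)) (k + 1) =
      hcoeff (fun z : ℂ => ((1 + (-r) * z)⁻¹) ^ m) (k + 1) +
        r * hcoeff (fun z : ℂ => ((1 + (-r) * z)⁻¹) ^ (m + 1)) k := by
  have h := hcoeff_affine_mul_succ (analyticAt_inv_pow r (m + 1)) 1 (-r) k
  have hc : (fun z : ℂ => (1 + (-r) * z) * ((1 + (-r) * z)⁻¹) ^ (m + 1)) =ᶠ[nhds 0]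
      fun z : ℂ => ((1 + (-r) * z)⁻¹) ^ m := by
    have : ∀ᶠ z : ℂ in nhds 0, 1 + (-r : ℂ) * z ≠ 0 :=
      ContinuousAt.eventually_ne (by fun_prop) (by simp)
    filter_upwards [this] with z hz
    linear_combination ((1 + (-r : ℂ) * z)⁻¹) ^ m * mul_inv_cancel₀ hz
  rw [hcoeff_congr hc] at h
  linear_combination -h

lemma hcoeff_inv_pow (r : ℝ) (m k : ℕ) :
    hcoeff (fun z : ℂ => ((1 + (-r) * z)⁻¹) ^ (m + 1)) k = ((k + m).choose m : ℂ) * r ^ k := by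
  induction m generalizing k with
  | zero =>
    induction k with
    | zero => simp [hcoeff_zero]
    | succ k ih =>
      rw [hcoeff_inv_pow_succ, ih]
      simp [hcoeff_const_one]
      ring
  | succ m ihm =>
    induction k with
    | zero => simp [hcoeff_zero]
    | succ k ih =>
      rw [hcoeff_inv_pow_succ, ih, ihm]
      have : (k + 1 + (m + 1)).choose (m + 1) =
          (k + 1 + m).choose m + (k + (m + 1)).choose (m + 1) := by
        rw [show k + 1 + (m + 1) = (k + 1 + m) + 1 by ring, Nat.choose_succ_succ,
          show k + (m + 1) = k + 1 + m by ring]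
      rw [this]
      push_cast
      ring

lemma cast_add_choose_two (k : ℕ) :
    (((k + 2).choose 2 : ℕ) : ℝ) = (k + 1) * (k + 2) / 2 := by
  have h := Nat.ascFactorial_eq_factorial_mul_choose k 2
  simp [Nat.ascFactorial, Nat.factorial] at h
  have h' := congrArg (Nat.cast : ℕ → ℝ) h
  push_cast at h'
  linarith

lemma cast_add_choose_three (k : ℕ) :
    (((k + 3).choose 3 : ℕ) : ℝ) = (k + 1) * (k + 2) * (k + 3) / 6 := by
  have h := Nat.ascFactorial_eq_factorial_mul_choose k 3
  simp [Nat.ascFactorial, Nat.factorial] at h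
  have h' := congrArg (Nat.cast : ℕ → ℝ) h
  push_cast at h'
  linarith

lemma cast_add_choose_four (k : ℕ) :
    (((k + 4).choose 4 : ℕ) : ℝ) = (k + 1) * (k + 2) * (k + 3) * (k + 4) / 24 := by
  have h := Nat.ascFactorial_eq_factorial_mul_choose k 4
  simp [Nat.ascFactorial, Nat.factorial] at h
  have h' := congrArg (Nat.cast : ℕ → ℝ) h
  push_cast at h'
  linarith

lemma hasSum_quartic_mul_geometric (A : ℝ) {x : ℝ} (hx0 : 0 ≤ x) (hx1 : x < 1) :
    HasSum (fun k : ℕ => (((k : ℝ) + 1) * (A * (k + 2) - k) / 2) ^ 2 * x ^ k)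
      (-(1 / (1 - x) ^ 2) + ((3 - A) ^ 2 - 2) * (1 / (1 - x) ^ 3) +
        (3 + 3 * ((3 - A) ^ 2 - 2) - 9 * (2 - A) ^ 2) * (1 / (1 - x) ^ 4) +
        6 * (A - 1) ^ 2 * (1 / (1 - x) ^ 5)) := by
  have hx : ‖x‖ < 1 := by rwa [Real.norm_of_nonneg hx0]
  have h1 := hasSum_choose_mul_geometric_of_norm_lt_one 1 hx
  have h2 := hasSum_choose_mul_geometric_of_norm_lt_one 2 hx
  have h3 := hasSum_choose_mul_geometric_of_norm_lt_one 3 hx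
  have h4 := hasSum_choose_mul_geometric_of_norm_lt_one 4 hx
  refine (((h1.neg.add (h2.mul_left _)).add (h3.mul_left _)).add (h4.mul_left _)).congr_fun ?_
  intro k
  rw [cast_add_choose_two, cast_add_choose_three, cast_add_choose_four, Nat.choose_one_right]
  push_cast
  ring

lemma norm_hcoeff_affine_mul_inv_cube (A c r : ℝ) (k : ℕ) :
    ‖hcoeff (fun z : ℂ => ((c * A : ℝ) + (-(c * r) : ℝ) * z) * ((1 + (-r) * z)⁻¹) ^ 3) k‖ ^ 2 =
      c ^ 2 * ((((k : ℝ) + 1) * (A * (k + 2) - k) / 2) ^ 2 * (r ^ 2) ^ k) := by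
  have h : hcoeff (fun z : ℂ => ((c * A : ℝ) + (-(c * r) : ℝ) * z) * ((1 + (-r) * z)⁻¹) ^ 3) k =
      ((c * (((k : ℝ) + 1) * (A * (k + 2) - k) / 2) * r ^ k : ℝ) : ℂ) := by
    rcases k with _ | k
    · simp [hcoeff_zero]
    · rw [hcoeff_affine_mul_succ (analyticAt_inv_pow r 3), hcoeff_inv_pow r 2, hcoeff_inv_pow r 2]
      have e1 := cast_add_choose_two k
      have e2 := cast_add_choose_two (k + 1)
      norm_cast
      rw [e1, e2]
      push_cast
      ring
  rw [h, Complex.norm_real, Real.norm_eq_abs, sq_abs]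
  ring

lemma deriv_mw_eventuallyEq (r : ℝ) (j : ℕ) :
    deriv (mw r (j + 2)) =ᶠ[nhds 0] fun z : ℂ =>
      (r + (-1) * z) ^ j * ((1 + (-r) * z)⁻¹) ^ j *
        (((√(1 - r ^ 2) * ((j + 2) * r ^ 2 - (j + 1)) : ℝ) +
          (-(√(1 - r ^ 2) * r) : ℝ) * z) * ((1 + (-r) * z)⁻¹) ^ 3) := by
  have hne : ∀ᶠ z : ℂ in nhds 0, 1 - (r : ℂ) * z ≠ 0 :=
    ContinuousAt.eventually_ne (by fun_prop) (by simp)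
  filter_upwards [hne] with z hz
  have hden : HasDerivAt (fun w : ℂ => 1 - (r : ℂ) * w) (-r) z := by
    simpa using ((hasDerivAt_id z).const_mul (r : ℂ)).const_sub 1
  have hnum : HasDerivAt (fun w : ℂ => (r : ℂ) - w) (-1) z := by
    simpa using (hasDerivAt_id z).const_sub (r : ℂ)
  have h := ((hasDerivAt_const z (√(1 - r ^ 2) : ℂ)).div hden hz).mul
    ((hnum.div hden hz).pow (j + 1))
  have hmw : mw r (j + 2) = fun w : ℂ => (√(1 - r ^ 2) : ℂ) / (1 - (r : ℂ) * w) *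
      (((r : ℂ) - w) / (1 - (r : ℂ) * w)) ^ (j + 1) := by
    funext w
    simp [mw, blaschke]
  rw [hmw]
  refine (h.deriv).trans ?_
  have e1 : 1 + (-r : ℂ) * z = 1 - r * z := by ring
  have e2 : (r : ℂ) + (-1) * z = r - z := by ring
  rw [e1, e2]
  simp only [Pi.pow_apply, Pi.div_apply, Nat.add_sub_cancel]
  push_cast
  simp only [pow_succ, div_pow, inv_pow]
  field_simp
  ring

/-- For `n ≥ 2`, `0 ≤ r < 1` and the Malmquist–Walsh function
`e_n(z) = (1-r²)^{1/2}/(1-rz)·b_r(z)^{n-1}`, one has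
`‖e_n'‖₂² = ((n-1)² + (2n-1)²r² + n²r⁴)/(1-r²)²`. -/
theorem stmt6 (n : ℕ) (hn : 2 ≤ n) (r : ℝ) (hr0 : 0 ≤ r) (hr1 : r < 1) :
    h2norm (deriv (mw r n)) ^ 2 =
      (((n : ℝ) - 1) ^ 2 + (2 * (n : ℝ) - 1) ^ 2 * r ^ 2 + (n : ℝ) ^ 2 * r ^ 4) /
        (1 - r ^ 2) ^ 2 := by
  obtain ⟨j, rfl⟩ : ∃ j, n = j + 2 := ⟨n - 2, by omega⟩
  have hx1 : r ^ 2 < 1 := by nlinarith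
  have hinv : DifferentiableOn ℂ (fun z : ℂ => (1 + (-r : ℂ) * z)⁻¹) (ball 0 (2 / (1 + r))) :=
    DifferentiableOn.inv (by fun_prop) fun z hz => one_sub_mul_ne_zero hr0 hr1 hz
  have hf : DifferentiableOn ℂ (fun z : ℂ =>
      ((√(1 - r ^ 2) * ((j + 2) * r ^ 2 - (j + 1)) : ℝ) + (-(√(1 - r ^ 2) * r) : ℝ) * z) *
        ((1 + (-r) * z)⁻¹) ^ 3) (ball 0 (2 / (1 + r))) :=
    DifferentiableOn.mul (by fun_prop) (hinv.pow 3)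
  rw [h2norm_congr (deriv_mw_eventuallyEq r j), h2norm_blaschke_pow_mul hr0 hr1
    hf, h2norm_sq]
  simp only [norm_hcoeff_affine_mul_inv_cube]
  rw [((hasSum_quartic_mul_geometric _ (sq_nonneg r) hx1).mul_left _).tsum_eq,
    Real.sq_sqrt (by linarith)]
  have : 1 - r ^ 2 ≠ 0 := by linarith
  push_cast
  field_simp
  ring
end
end
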